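/- Fix α > 0, K₁ > 0, K₃ > 0, K₄ > 0, K₅ ≠ 0 and K₂ ∈ ℝ. Let K₆ = (K₁·K₃ + K₅²)/K₁. The strictly concave function δ ↦ −(α/2)·K₁·δ² + K₂·δ − (1/(2αK₃))·(PL(K₄·e^{−α·K₅·δ})² + 2·PL(K₄·e^{−α·K₅·δ})) has a unique maximizer δ̂ = K₂/(α·K₁) + (K₅/(α·K₁·K₆))·PL((K₄·K₆/K₃)·e^{−K₅·K₂/K₁}), which satisfies the first-order condition 0 = −α·K₁·δ̂ + K₂ + (K₅/K₃)·PL(K₄·e^{−α·K₅·δ̂}). -/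

import Mathlib

open Real

/-- Fix `α > 0`, `K₁ > 0`, `K₃ > 0`, `K₄ > 0`, `K₅ ≠ 0`, `K₂ ∈ ℝ`, and let
`K₆ = (K₁K₃ + K₅²)/K₁`. The strictly concave function
`δ ↦ -(α/2)K₁δ² + K₂δ - (1/(2αK₃))(PL(K₄ e^{-αK₅δ})² + 2 PL(K₄ e^{-αK₅δ}))`
has a unique maximizer
`δ̂ = K₂/(αK₁) + (K₅/(αK₁K₆)) PL((K₄K₆/K₃) e^{-K₅K₂/K₁})`, which satisfies the
first-order condition `0 = -αK₁δ̂ + K₂ + (K₅/K₃) PL(K₄ e^{-αK₅δ̂})`. -/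
theorem cds_optimal_position_incomplete
    (PL : ℝ → ℝ)
    (hPLpos : ∀ w : ℝ, 0 < w → 0 < PL w)
    (hPL : ∀ w : ℝ, 0 < w → PL w * Real.exp (PL w) = w)
    (α K₁ K₂ K₃ K₄ K₅ : ℝ) (hα : 0 < α) (hK₁ : 0 < K₁) (hK₃ : 0 < K₃)
    (hK₄ : 0 < K₄) (hK₅ : K₅ ≠ 0)
    (K₆ : ℝ) (hK₆ : K₆ = (K₁ * K₃ + K₅ ^ 2) / K₁)
    (f : ℝ → ℝ)
    (hf : ∀ δ : ℝ, f δ = -(α / 2) * K₁ * δ ^ 2 + K₂ * δ -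
      (1 / (2 * α * K₃)) * ((PL (K₄ * Real.exp (-α * K₅ * δ))) ^ 2
        + 2 * PL (K₄ * Real.exp (-α * K₅ * δ))))
    (δhat : ℝ)
    (hδhat : δhat = K₂ / (α * K₁) +
      (K₅ / (α * K₁ * K₆)) * PL ((K₄ * K₆ / K₃) * Real.exp (-K₅ * K₂ / K₁))) :
    (∀ δ : ℝ, f δ ≤ f δhat) ∧
    (∀ δ : ℝ, (∀ δ' : ℝ, f δ' ≤ f δ) → δ = δhat) ∧
    0 = -α * K₁ * δhat + K₂ + (K₅ / K₃) * PL (K₄ * Real.exp (-α * K₅ * δhat)) := by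
  have hK₆pos : 0 < K₆ := by rw [hK₆]; positivity
  have hK₅sq : K₅ ^ 2 / K₁ = K₆ - K₃ := by rw [hK₆]; field_simp; ring
  -- logarithmic form of the defining equation
  have hlog : ∀ δ : ℝ, PL (K₄ * Real.exp (-α * K₅ * δ)) +
      Real.log (PL (K₄ * Real.exp (-α * K₅ * δ))) = Real.log K₄ - α * K₅ * δ := by
    intro δ
    have hw : 0 < K₄ * Real.exp (-α * K₅ * δ) := by positivity
    have h := congrArg Real.log (hPL _ hw)
    rw [Real.log_mul (hPLpos _ hw).ne' (Real.exp_pos _).ne', Real.log_exp,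
      Real.log_mul hK₄.ne' (Real.exp_pos _).ne', Real.log_exp] at h
    linarith
  have hinj : ∀ x y : ℝ, 0 < x → 0 < y → x + Real.log x = y + Real.log y → x = y := by
    intro x y hx hy h
    rcases lt_trichotomy x y with hlt | heq | hgt
    · have := Real.log_lt_log hx hlt
      linarith
    · exact heq
    · have := Real.log_lt_log hy hgt
      linarith
  have hupos : ∀ δ : ℝ, 0 < PL (K₄ * Real.exp (-α * K₅ * δ)) :=
    fun δ => hPLpos _ (by positivity)
  have hw0 : 0 < (K₄ * K₆ / K₃) * Real.exp (-K₅ * K₂ / K₁) := by positivity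
  have hvpos := hPLpos _ hw0
  have hv := congrArg Real.log (hPL _ hw0)
  rw [Real.log_mul hvpos.ne' (Real.exp_pos _).ne', Real.log_exp,
    Real.log_mul (by positivity) (Real.exp_pos _).ne', Real.log_exp,
    Real.log_div (by positivity) hK₃.ne', Real.log_mul hK₄.ne' hK₆pos.ne'] at hv
  generalize PL ((K₄ * K₆ / K₃) * Real.exp (-K₅ * K₂ / K₁)) = v at hvpos hv hδhat
  have hq : PL (K₄ * Real.exp (-α * K₅ * δhat)) = K₃ * v / K₆ := by
    apply hinj _ _ (hupos _) (by positivity)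
    rw [hlog, Real.log_div (by positivity) hK₆pos.ne', Real.log_mul hK₃.ne' hvpos.ne']
    have h1 : α * K₅ * δhat = K₅ * K₂ / K₁ + (K₅ ^ 2 / K₁) * v / K₆ := by
      rw [hδhat]; field_simp
    have h2 : (K₅ ^ 2 / K₁) * v / K₆ = v - K₃ * v / K₆ := by
      rw [hK₅sq]; field_simp
    have h3 : -K₅ * K₂ / K₁ = -(K₅ * K₂ / K₁) := by ring
    rw [h1, h2]
    rw [h3] at hv
    linarith
  have hfoc : 0 = -α * K₁ * δhat + K₂ +
      (K₅ / K₃) * PL (K₄ * Real.exp (-α * K₅ * δhat)) := by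
    rw [hq, hδhat]; field_simp; ring
  have key : ∀ δ : ℝ, f δ + α / 2 * K₁ * (δ - δhat) ^ 2 ≤ f δhat := by
    intro δ
    have hp := hupos δ
    have hq' := hupos δhat
    have lp := hlog δ
    have lq := hlog δhat
    rw [hf, hf]
    generalize PL (K₄ * Real.exp (-α * K₅ * δ)) = p at *
    generalize PL (K₄ * Real.exp (-α * K₅ * δhat)) = q at *
    have h1 : q * (Real.log p - Real.log q) ≤ p - q := by
      rw [← Real.log_div hp.ne' hq'.ne']
      have := Real.log_le_sub_one_of_pos (div_pos hp hq')
      calc q * Real.log (p / q) ≤ q * (p / q - 1) := by gcongr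
        _ = p - q := by field_simp
    have h2 : Real.log p - Real.log q = q - p - α * K₅ * (δ - δhat) := by linarith
    rw [h2] at h1
    have h3 : 0 ≤ (p ^ 2 + 2 * p) - (q ^ 2 + 2 * q) + 2 * q * (α * K₅ * (δ - δhat)) := by
      nlinarith [sq_nonneg (p - q)]
    have h4 : 0 ≤ 1 / (2 * α * K₃) *
        ((p ^ 2 + 2 * p) - (q ^ 2 + 2 * q) + 2 * q * (α * K₅ * (δ - δhat))) := by positivity
    have h5 : 1 / (2 * α * K₃) *
        ((p ^ 2 + 2 * p) - (q ^ 2 + 2 * q) + 2 * q * (α * K₅ * (δ - δhat))) =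
        1 / (2 * α * K₃) * (p ^ 2 + 2 * p) - 1 / (2 * α * K₃) * (q ^ 2 + 2 * q) +
          (K₅ / K₃ * q) * (δ - δhat) := by field_simp
    have h6 : K₅ / K₃ * q = α * K₁ * δhat - K₂ := by linarith
    rw [h5, h6] at h4
    linarith
  refine ⟨fun δ => ?_, fun δ hδ => ?_, hfoc⟩
  · have := key δ
    have h : 0 ≤ α / 2 * K₁ * (δ - δhat) ^ 2 := by positivity
    linarith
  · by_contra hne
    have h0 : δ - δhat ≠ 0 := sub_ne_zero.mpr hne
    have h : 0 < α / 2 * K₁ * (δ - δhat) ^ 2 := by positivity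
    linarith [key δ, hδ δhat]
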